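/- arXiv:2505.01293 — 6 statements merged into one kernel-verified Lean document; each statement's English description precedes it below -/
import Mathlib

section
/- Let M, N ∈ ℝ^{n×n} be lower triangular matrices (i.e., M_{ij} = N_{ij} = 0 whenever j > i) such that M_{ii} > |N_{ii}| for every i. Then for every c ∈ ℝ^n, the lower triangular generalized absolute value system M x − N |x| = c has exactly one solution x ∈ ℝ^n. -/
open Matrix

/-- The scalar absolute value equation `m t − k |t| = d` is uniquely solvable when `|k| < m`. -/
theorem existsUnique_mul_sub_mul_abs {m k : ℝ} (h : |k| < m) (d : ℝ) :
    ∃! t : ℝ, m * t - k * |t| = d := by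
  obtain ⟨h₁, h₂⟩ := abs_lt.mp h
  have hsub : 0 < m - k := by linarith
  have hadd : 0 < m + k := by linarith
  refine existsUnique_of_exists_of_unique ?_ ?_
  · rcases le_total 0 d with hd | hd
    · refine ⟨d / (m - k), ?_⟩
      rw [abs_of_nonneg (by positivity)]
      field_simp
    · refine ⟨d / (m + k), ?_⟩
      rw [abs_of_nonpos (div_nonpos_of_nonpos_of_nonneg hd hadd.le)]
      field_simp
      ring
  · intro s t hs ht
    have hlip : |k * (|s| - |t|)| ≤ |k| * |s - t| := by
      rw [abs_mul]
      exact mul_le_mul_of_nonneg_left (abs_abs_sub_abs_le_abs_sub s t) (abs_nonneg k)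
    have heq : m * (s - t) = k * (|s| - |t|) := by linarith
    rw [← heq, abs_mul, abs_of_pos ((abs_nonneg k).trans_lt h)] at hlip
    by_contra hne
    exact (mul_lt_mul_of_pos_right h (abs_pos.mpr (sub_ne_zero.mpr hne))).not_ge hlip

/-- Forward substitution: a lower triangular system splits into its first row and the system
for the remaining unknowns. -/
theorem mulVec_cons_sub_mulVec_abs_cons_eq_iff {n : ℕ}
    {M N : Matrix (Fin (n + 1)) (Fin (n + 1)) ℝ}
    (hM : ∀ j : Fin n, M 0 j.succ = 0) (hN : ∀ j : Fin n, N 0 j.succ = 0)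
    (c : Fin (n + 1) → ℝ) (t : ℝ) (y : Fin n → ℝ) :
    M.mulVec (Fin.cons t y : Fin (n + 1) → ℝ) -
        N.mulVec (fun i => |(Fin.cons t y : Fin (n + 1) → ℝ) i|) = c ↔
      M 0 0 * t - N 0 0 * |t| = c 0 ∧
        (M.submatrix Fin.succ Fin.succ).mulVec y -
            (N.submatrix Fin.succ Fin.succ).mulVec (fun i => |y i|) =
          fun i => c i.succ - M i.succ 0 * t + N i.succ 0 * |t| := by
  simp only [funext_iff, Fin.forall_fin_succ, Pi.sub_apply, mulVec, dotProduct,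
    Fin.sum_univ_succ, Fin.cons_zero, Fin.cons_succ, submatrix_apply, hM, hN, zero_mul,
    Finset.sum_const_zero, add_zero]
  refine and_congr_right fun _ => forall_congr' fun i => ?_
  constructor <;> intro h <;> linarith

/-- Let `M, N ∈ ℝ^{n×n}` be lower triangular matrices (entries vanish when the column
index exceeds the row index) such that `M_{ii} > |N_{ii}|` for every `i`. Then for every
`c ∈ ℝ^n`, the lower triangular generalized absolute value system `M x − N |x| = c`
has exactly one solution `x ∈ ℝ^n`. -/
theorem lower_triangular_gave_unique_solution {n : ℕ}
    (M N : Matrix (Fin n) (Fin n) ℝ)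
    (hM : ∀ i j : Fin n, i < j → M i j = 0)
    (hN : ∀ i j : Fin n, i < j → N i j = 0)
    (hdiag : ∀ i : Fin n, M i i > |N i i|)
    (c : Fin n → ℝ) :
    ∃! x : Fin n → ℝ, M.mulVec x - N.mulVec (fun i => |x i|) = c := by
  induction n with
  | zero => exact ⟨0, Subsingleton.elim _ _, fun _ _ => Subsingleton.elim _ _⟩
  | succ n ih =>
    have hM₀ : ∀ j : Fin n, M 0 j.succ = 0 := fun j => hM _ _ j.succ_pos
    have hN₀ : ∀ j : Fin n, N 0 j.succ = 0 := fun j => hN _ _ j.succ_pos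
    obtain ⟨t, ht, ht_unique⟩ := existsUnique_mul_sub_mul_abs (hdiag 0) (c 0)
    obtain ⟨y, hy, hy_unique⟩ := ih (M.submatrix Fin.succ Fin.succ)
      (N.submatrix Fin.succ Fin.succ)
      (fun i j hij => hM _ _ (Fin.succ_lt_succ_iff.mpr hij))
      (fun i j hij => hN _ _ (Fin.succ_lt_succ_iff.mpr hij))
      (fun i => hdiag i.succ)
      (fun i => c i.succ - M i.succ 0 * t + N i.succ 0 * |t|)
    refine ⟨Fin.cons t y,
      (mulVec_cons_sub_mulVec_abs_cons_eq_iff hM₀ hN₀ c t y).mpr ⟨ht, hy⟩, ?_⟩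
    intro x hx
    induction x using Fin.consCases with
    | cons s z =>
      obtain ⟨hs, hz⟩ := (mulVec_cons_sub_mulVec_abs_cons_eq_iff hM₀ hN₀ c s z).mp hx
      obtain rfl := ht_unique s hs
      rw [hy_unique z hz]
end

section
/- Let A, B ∈ ℝ^{n×n} with decompositions A = D_A − L_A − U_A and B = D_B − L_B − U_B into diagonal, strictly lower triangular, and strictly upper triangular parts, and let b ∈ ℝ^n. Assume A_{ii} > |B_{ii}| for all i. If x ∈ ℝ^n satisfies A x − B |x| = b and y ∈ ℝ^n satisfies the GGS step equation (D_A − L_A)y − (D_B − L_B)|y| = U_A x − U_B |x| + b, then y = x. In other words, every solution of the GAVE is a fixed point of the GGS iteration. -/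
open Matrix

/-- A lower triangular pair `M`, `N` with `|N i i| < M i i` makes `x ↦ M x − N |x|` injective. -/
theorem mulVec_sub_mulVec_abs_injective_of_lowerTriangular {n : ℕ}
    {M N : Matrix (Fin n) (Fin n) ℝ}
    (hM : ∀ i j, i < j → M i j = 0) (hN : ∀ i j, i < j → N i j = 0)
    (hdiag : ∀ i, |N i i| < M i i) :
    Function.Injective fun x : Fin n → ℝ => M *ᵥ x - N *ᵥ fun i => |x i| := by
  intro y x h
  funext i
  induction i using WellFoundedLT.induction with
  | ind i ih =>
    have hrow : ∑ j, (M i j * (y j - x j) - N i j * (|y j| - |x j|)) = 0 := by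
      have hi := congrFun h i
      simp only [Pi.sub_apply, mulVec, dotProduct] at hi
      simp only [mul_sub, Finset.sum_sub_distrib]
      linarith
    rw [Finset.sum_eq_single i] at hrow
    · by_contra hne
      have hpos : 0 < |y i - x i| := abs_pos.mpr (sub_ne_zero.mpr hne)
      have habs : |M i i| * |y i - x i| = |N i i| * |(|y i| - |x i|)| := by
        rw [← abs_mul, ← abs_mul, sub_eq_zero.mp hrow]
      have hle : |N i i| * |(|y i| - |x i|)| ≤ |N i i| * |y i - x i| :=
        mul_le_mul_of_nonneg_left (abs_abs_sub_abs_le _ _) (abs_nonneg _)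
      have hlt : |N i i| * |y i - x i| < |M i i| * |y i - x i| :=
        mul_lt_mul_of_pos_right ((hdiag i).trans_le (le_abs_self _)) hpos
      linarith
    · intro j _ hj
      rcases lt_or_gt_of_ne hj with hlt | hgt
      · simp [ih j hlt]
      · simp [hM i j hgt, hN i j hgt]
    · simp

/-- Every solution of the GAVE `A x − B |x| = b` is a fixed point of the GGS iteration:
if `x` solves the GAVE and `y` solves the GGS step with input `x`, then `y = x`. -/
theorem gave_solution_is_ggs_fixed_point {n : ℕ}
    (A B DA LA UA DB LB UB : Matrix (Fin n) (Fin n) ℝ)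
    (hDA : ∀ i j : Fin n, i ≠ j → DA i j = 0)
    (hLA : ∀ i j : Fin n, ¬ j < i → LA i j = 0)
    (hUA : ∀ i j : Fin n, ¬ i < j → UA i j = 0)
    (hA : A = DA - LA - UA)
    (hDB : ∀ i j : Fin n, i ≠ j → DB i j = 0)
    (hLB : ∀ i j : Fin n, ¬ j < i → LB i j = 0)
    (hUB : ∀ i j : Fin n, ¬ i < j → UB i j = 0)
    (hB : B = DB - LB - UB)
    (hdiag : ∀ i : Fin n, A i i > |B i i|)
    (b x y : Fin n → ℝ)
    (hx : A.mulVec x - B.mulVec (fun i => |x i|) = b)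
    (hy : (DA - LA).mulVec y - (DB - LB).mulVec (fun i => |y i|) =
      UA.mulVec x - UB.mulVec (fun i => |x i|) + b) :
    y = x := by
  refine mulVec_sub_mulVec_abs_injective_of_lowerTriangular (M := DA - LA) (N := DB - LB)
    ?_ ?_ ?_ ?_
  · intro i j hij
    simp [hDA i j hij.ne, hLA i j hij.not_gt]
  · intro i j hij
    simp [hDB i j hij.ne, hLB i j hij.not_gt]
  · intro i
    simpa [hA, hB, hUA i i (lt_irrefl i), hUB i i (lt_irrefl i)] using hdiag i
  · refine hy.trans ?_
    beta_reduce
    rw [← hx, hA, hB, sub_mulVec _ UA, sub_mulVec _ UB]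
    abel
end

section
/- Let A, B ∈ ℝ^{n×n}. Assume A_{ii} > |B_{ii}| for all i and that the comparison matrix minus absolute value, ⟨A⟩ − |B|, is an M-matrix. Write A = D_A − L_A − U_A and B = D_B − L_B − U_B as diagonal minus strictly lower triangular minus strictly upper triangular parts. Then ⟨D_A − L_A⟩ − |D_B − L_B| is an invertible matrix with entrywise nonnegative inverse, and the spectral radius of L̂ = (⟨D_A − L_A⟩ − |D_B − L_B|)^{-1}(|U_A| + |U_B|) satisfies ρ(L̂) < 1. -/
open Matrix

/-- Entrywise absolute value of a matrix. -/
def matAbs {n : ℕ} (M : Matrix (Fin n) (Fin n) ℝ) : Matrix (Fin n) (Fin n) ℝ :=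
  Matrix.of fun i j => |M i j|

/-- The comparison matrix `⟨A⟩`: `⟨A⟩_{ii} = |A_{ii}|`, `⟨A⟩_{ij} = −|A_{ij}|` for `i ≠ j`. -/
def compMat {n : ℕ} (A : Matrix (Fin n) (Fin n) ℝ) : Matrix (Fin n) (Fin n) ℝ :=
  Matrix.of fun i j => if i = j then |A i j| else -|A i j|

/-- An M-matrix: a Z-matrix which is invertible with entrywise nonnegative inverse. -/
def IsMMatrix {n : ℕ} (M : Matrix (Fin n) (Fin n) ℝ) : Prop :=
  (∀ i j : Fin n, i ≠ j → M i j ≤ 0) ∧ IsUnit M ∧ ∀ i j : Fin n, 0 ≤ M⁻¹ i j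

/-- The spectral radius of a real matrix: the supremum of the absolute values of
its complex eigenvalues. -/
noncomputable def specRad {n : ℕ} (M : Matrix (Fin n) (Fin n) ℝ) : ENNReal :=
  spectralRadius ℂ (M.map (Complex.ofReal))

/-- A Z-matrix that maps a nonnegative vector to a positive vector forces the vector to be
positive. -/
theorem pos_of_mulVec_pos {n : ℕ} {N : Matrix (Fin n) (Fin n) ℝ}
    (hZ : ∀ i j, i ≠ j → N i j ≤ 0) {v : Fin n → ℝ} (hv : ∀ i, 0 ≤ v i)
    (hNv : ∀ i, 0 < (N *ᵥ v) i) (i : Fin n) : 0 < v i := by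
  refine (hv i).lt_of_ne fun h => (hNv i).not_ge ?_
  simp only [mulVec, dotProduct]
  refine Finset.sum_nonpos fun j _ => ?_
  by_cases hij : i = j
  · simp [← hij, ← h]
  · exact mul_nonpos_of_nonpos_of_nonneg (hZ i j hij) (hv j)

/-- A Z-matrix that maps some positive vector to a positive vector is monotone. -/
theorem nonneg_of_mulVec_nonneg {n : ℕ} {N : Matrix (Fin n) (Fin n) ℝ}
    (hZ : ∀ i j, i ≠ j → N i j ≤ 0) {v : Fin n → ℝ} (hv : ∀ i, 0 < v i)
    (hNv : ∀ i, 0 < (N *ᵥ v) i) {x : Fin n → ℝ} (hx : ∀ i, 0 ≤ (N *ᵥ x) i) (k : Fin n) :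
    0 ≤ x k := by
  have : Nonempty (Fin n) := ⟨k⟩
  obtain ⟨i, hi⟩ := Finite.exists_min fun j => x j / v j
  rcases le_or_gt 0 (x i / v i) with ht | ht
  · have h := ht.trans (hi k)
    rwa [le_div_iff₀ (hv k), zero_mul] at h
  · exfalso
    set t := x i / v i with htdef
    have h1 : (N *ᵥ (x - t • v)) i = (N *ᵥ x) i - t * (N *ᵥ v) i := by
      simp [mulVec_sub, mulVec_smul]
    have h2 : (N *ᵥ (x - t • v)) i ≤ 0 := by
      simp only [mulVec, dotProduct]
      refine Finset.sum_nonpos fun j _ => ?_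
      by_cases hij : i = j
      · have : x i - t * v i = 0 := by
          rw [htdef, div_mul_cancel₀ _ (hv i).ne', sub_self]
        simp [← hij, this]
      · refine mul_nonpos_of_nonpos_of_nonneg (hZ i j hij) ?_
        have := (le_div_iff₀ (hv j)).1 (hi j)
        simpa using this
    nlinarith [hx i, mul_neg_of_neg_of_pos ht (hNv i)]

/-- A Z-matrix that maps some positive vector to a positive vector is an M-matrix. -/
theorem isMMatrix_of_mulVec_pos {n : ℕ} {N : Matrix (Fin n) (Fin n) ℝ}
    (hZ : ∀ i j, i ≠ j → N i j ≤ 0) {v : Fin n → ℝ} (hv : ∀ i, 0 < v i)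
    (hNv : ∀ i, 0 < (N *ᵥ v) i) : IsMMatrix N := by
  have hunit : IsUnit N := by
    rw [← mulVec_injective_iff_isUnit]
    refine fun x y hxy => funext fun i => le_antisymm ?_ ?_
    · have := nonneg_of_mulVec_nonneg hZ hv hNv (x := y - x)
        (fun j => by simp [mulVec_sub, show N *ᵥ x = N *ᵥ y from hxy]) i
      simpa using this
    · have := nonneg_of_mulVec_nonneg hZ hv hNv (x := x - y)
        (fun j => by simp [mulVec_sub, show N *ᵥ x = N *ᵥ y from hxy]) i
      simpa using this
  refine ⟨hZ, hunit, fun i j => ?_⟩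
  refine nonneg_of_mulVec_nonneg hZ hv hNv (x := fun k => N⁻¹ k j) (fun k => ?_) i
  change 0 ≤ (N * N⁻¹) k j
  rw [mul_nonsing_inv _ ((isUnit_iff_isUnit_det N).1 hunit), one_apply]
  split_ifs <;> norm_num

/-- An M-matrix maps some positive vector to the all-ones vector. -/
theorem IsMMatrix.exists_pos_mulVec_eq_one {n : ℕ} {M : Matrix (Fin n) (Fin n) ℝ}
    (hM : IsMMatrix M) : (∀ i, 0 < (M⁻¹ *ᵥ 1) i) ∧ M *ᵥ (M⁻¹ *ᵥ 1) = 1 := by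
  obtain ⟨hZ, hunit, hinv⟩ := hM
  have h1 : M *ᵥ (M⁻¹ *ᵥ 1) = 1 := by
    rw [mulVec_mulVec, mul_nonsing_inv _ ((isUnit_iff_isUnit_det M).1 hunit), one_mulVec]
  refine ⟨pos_of_mulVec_pos hZ (fun i => ?_) fun i => ?_, h1⟩
  · simpa [mulVec, dotProduct] using Finset.sum_nonneg fun j _ => hinv i j
  · simp [h1]

/-- A nonnegative matrix `T` with `T v < v` for some positive vector `v` has spectral radius less
than one. -/
theorem specRad_lt_one_of_mulVec_lt {n : ℕ} {T : Matrix (Fin n) (Fin n) ℝ}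
    (hT : ∀ i j, 0 ≤ T i j) {v : Fin n → ℝ} (hv : ∀ i, 0 < v i)
    (hTv : ∀ i, (T *ᵥ v) i < v i) : specRad T < 1 := by
  have hlt : ∀ μ ∈ spectrum ℂ (T.map Complex.ofReal), ‖μ‖ < 1 := by
    intro μ hμ
    rw [← spectrum_toLin', ← Module.End.hasEigenvalue_iff_mem_spectrum] at hμ
    obtain ⟨x, hx⟩ := hμ.exists_hasEigenvector
    have hxe : (T.map Complex.ofReal) *ᵥ x = μ • x := by simpa using hx.apply_eq_smul
    obtain ⟨k, hk⟩ := Function.ne_iff.1 hx.2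
    have : Nonempty (Fin n) := ⟨k⟩
    obtain ⟨i, hi⟩ := Finite.exists_max fun j => ‖x j‖ / v j
    set t := ‖x i‖ / v i with ht
    have htpos : 0 < t := (div_pos (norm_pos_iff.2 hk) (hv k)).trans_le (hi k)
    have hxi : ‖x i‖ = t * v i := by rw [ht, div_mul_cancel₀ _ (hv i).ne']
    have hle : ‖μ‖ * ‖x i‖ ≤ t * (T *ᵥ v) i := by
      rw [← norm_mul, ← smul_eq_mul, ← Pi.smul_apply, ← hxe]
      simp only [mulVec, dotProduct, Finset.mul_sum]
      refine (norm_sum_le _ _).trans ?_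
      refine Finset.sum_le_sum fun j _ => ?_
      have h1 : ‖x j‖ ≤ t * v j := (div_le_iff₀ (hv j)).1 (hi j)
      have h2 : ‖(T.map Complex.ofReal) i j * x j‖ = T i j * ‖x j‖ := by
        simp [abs_of_nonneg (hT i j)]
      calc _ = T i j * ‖x j‖ := h2
        _ ≤ T i j * (t * v j) := mul_le_mul_of_nonneg_left h1 (hT i j)
        _ = _ := by ring
    have hlt' : ‖μ‖ * ‖x i‖ < 1 * ‖x i‖ := by
      rw [one_mul]
      exact hle.trans_lt (hxi ▸ mul_lt_mul_of_pos_left (hTv i) htpos)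
    exact lt_of_mul_lt_mul_right hlt' (norm_nonneg _)
  have hfin := Matrix.finite_spectrum (T.map Complex.ofReal)
  have hsup : specRad T = hfin.toFinset.sup fun μ => (‖μ‖₊ : ENNReal) := by
    simp [specRad, spectralRadius, Finset.sup_eq_iSup]
  rw [hsup, Finset.sup_lt_iff (by simp)]
  intro μ hμ
  exact_mod_cast hlt μ (hfin.mem_toFinset.1 hμ)

/-- If `M = N - U` is an M-matrix with `0 ≤ U` and `N` a Z-matrix, then `N` is an M-matrix and
`N⁻¹ U` has spectral radius less than one. -/
theorem isMMatrix_and_specRad_lt_one_of_regular_splitting {n : ℕ}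
    {M N U : Matrix (Fin n) (Fin n) ℝ} (hM : IsMMatrix M) (hMN : M = N - U)
    (hU : ∀ i j, 0 ≤ U i j) (hZ : ∀ i j, i ≠ j → N i j ≤ 0) :
    IsMMatrix N ∧ specRad (N⁻¹ * U) < 1 := by
  obtain ⟨hv, hMv⟩ := hM.exists_pos_mulVec_eq_one
  set v := M⁻¹ *ᵥ 1
  have hNv : ∀ i, 0 < (N *ᵥ v) i := by
    intro i
    have h1 : N *ᵥ v = 1 + U *ᵥ v := by
      rw [← hMv, ← add_mulVec, hMN, sub_add_cancel]
    have h2 : 0 ≤ (U *ᵥ v) i := by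
      simp only [mulVec, dotProduct]
      exact Finset.sum_nonneg fun j _ => mul_nonneg (hU i j) (hv j).le
    rw [h1, Pi.add_apply, Pi.one_apply]
    linarith
  have hN := isMMatrix_of_mulVec_pos hZ hv hNv
  refine ⟨hN, specRad_lt_one_of_mulVec_lt (fun i j => ?_) hv fun i => ?_⟩
  · rw [mul_apply]
    exact Finset.sum_nonneg fun k _ => mul_nonneg (hN.2.2 i k) (hU k j)
  · have hdet := (isUnit_iff_isUnit_det N).1 hN.2.1
    have h1 : (N⁻¹ * U) *ᵥ v = v - N⁻¹ *ᵥ 1 := by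
      have hU' : N⁻¹ * U = 1 - N⁻¹ * M := by
        rw [hMN, mul_sub, nonsing_inv_mul _ hdet, sub_sub_cancel]
      rw [hU', sub_mulVec, one_mulVec, ← mulVec_mulVec, hMv]
    rw [h1, Pi.sub_apply]
    linarith [hN.exists_pos_mulVec_eq_one.1 i]

/-- If `A_{ii} > |B_{ii}|` and `⟨A⟩ − |B|` is an M-matrix, then
`⟨D_A − L_A⟩ − |D_B − L_B|` is invertible with nonnegative inverse and the iteration
matrix `L̂ = (⟨D_A − L_A⟩ − |D_B − L_B|)⁻¹ (|U_A| + |U_B|)` satisfies `ρ(L̂) < 1`. -/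
theorem ggs_iteration_matrix_spectral_radius_lt_one {n : ℕ}
    (A B DA LA UA DB LB UB : Matrix (Fin n) (Fin n) ℝ)
    (hDA : ∀ i j : Fin n, i ≠ j → DA i j = 0)
    (hLA : ∀ i j : Fin n, ¬ j < i → LA i j = 0)
    (hUA : ∀ i j : Fin n, ¬ i < j → UA i j = 0)
    (hA : A = DA - LA - UA)
    (hDB : ∀ i j : Fin n, i ≠ j → DB i j = 0)
    (hLB : ∀ i j : Fin n, ¬ j < i → LB i j = 0)
    (hUB : ∀ i j : Fin n, ¬ i < j → UB i j = 0)
    (hB : B = DB - LB - UB)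
    (hdiag : ∀ i : Fin n, A i i > |B i i|)
    (hM : IsMMatrix (compMat A - matAbs B)) :
    IsUnit (compMat (DA - LA) - matAbs (DB - LB)) ∧
    (∀ i j : Fin n, 0 ≤ (compMat (DA - LA) - matAbs (DB - LB))⁻¹ i j) ∧
    specRad ((compMat (DA - LA) - matAbs (DB - LB))⁻¹ * (matAbs UA + matAbs UB)) < 1 := by
  refine (fun h => ⟨h.1.2.1, h.1.2.2, h.2⟩)
    (isMMatrix_and_specRad_lt_one_of_regular_splitting hM ?_ (fun i j => ?_) fun i j hij => ?_)
  · subst hA hB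
    ext i j
    rcases lt_trichotomy i j with h | h | h
    · simp [compMat, matAbs, h.ne, hDA i j h.ne, hDB i j h.ne, hLA i j h.not_gt, hLB i j h.not_gt]
      ring
    · subst h
      simp [compMat, matAbs, hLA i i, hLB i i, hUA i i, hUB i i]
    · simp [compMat, matAbs, h.ne', hDA i j h.ne', hDB i j h.ne', hUA i j h.not_gt,
        hUB i j h.not_gt]
  · exact add_nonneg (abs_nonneg _) (abs_nonneg _)
  · have h1 := abs_nonneg ((DA - LA) i j)
    have h2 := abs_nonneg ((DB - LB) i j)
    simp only [compMat, matAbs, Matrix.sub_apply, of_apply, if_neg hij] at h1 h2 ⊢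
    linarith
end

section
/- Let A, B ∈ ℝ^{n×n} with decompositions A = D_A − L_A − U_A and B = D_B − L_B − U_B into diagonal, strictly lower triangular, and strictly upper triangular parts, and let b ∈ ℝ^n. Assume A_{ii} > |B_{ii}| for all i and that ⟨A⟩ − |B| is an M-matrix. Let x, y, z ∈ ℝ^n satisfy the two consecutive GGS iteration equations (D_A − L_A)y − (D_B − L_B)|y| = U_A x − U_B |x| + b and (D_A − L_A)z − (D_B − L_B)|z| = U_A y − U_B |y| + b. Then the entrywise inequality |z − y| ≤ L̂ |y − x| holds, where L̂ = (⟨D_A − L_A⟩ − |D_B − L_B|)^{-1}(|U_A| + |U_B|). -/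
open Matrix

/-- `|M v| ≤ |M| u` entrywise whenever `|v| ≤ u` entrywise. -/
theorem abs_mulVec_le_matAbs_mulVec {n : ℕ} (M : Matrix (Fin n) (Fin n) ℝ) {v u : Fin n → ℝ}
    (h : ∀ j, |v j| ≤ u j) (i : Fin n) : |M.mulVec v i| ≤ (matAbs M).mulVec u i := by
  simp only [mulVec, dotProduct, matAbs, of_apply]
  refine (Finset.abs_sum_le_sum_abs _ _).trans (Finset.sum_le_sum fun j _ => ?_)
  rw [abs_mul]
  exact mul_le_mul_of_nonneg_left (h j) (abs_nonneg _)

/-- `⟨M⟩ |v| ≤ |M v|` entrywise. -/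
theorem compMat_mulVec_abs_le {n : ℕ} (M : Matrix (Fin n) (Fin n) ℝ) (v : Fin n → ℝ)
    (i : Fin n) : (compMat M).mulVec (fun j => |v j|) i ≤ |M.mulVec v i| := by
  simp only [mulVec, dotProduct, compMat, of_apply]
  rw [← Finset.add_sum_erase _ _ (Finset.mem_univ i),
    ← Finset.add_sum_erase _ _ (Finset.mem_univ i)]
  have hoff : ∑ j ∈ Finset.univ.erase i, (if i = j then |M i j| else -|M i j|) * |v j| =
      -∑ j ∈ Finset.univ.erase i, |M i j * v j| := by
    rw [← Finset.sum_neg_distrib]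
    refine Finset.sum_congr rfl fun j hj => ?_
    rw [if_neg (Finset.ne_of_mem_erase hj).symm, abs_mul, neg_mul]
  have hsum := Finset.abs_sum_le_sum_abs (fun j => M i j * v j) (Finset.univ.erase i)
  have htri := abs_sub_abs_le_abs_sub (M i i * v i) (-∑ j ∈ Finset.univ.erase i, M i j * v j)
  rw [abs_neg, sub_neg_eq_add] at htri
  rw [hoff, if_pos rfl, ← abs_mul]
  linarith

/-- A lower triangular Z-matrix with positive diagonal is monotone. -/
theorem nonneg_of_lowerTriangular_mulVec_nonneg {n : ℕ} {T : Matrix (Fin n) (Fin n) ℝ}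
    (hupper : ∀ i j, i < j → T i j = 0) (hlower : ∀ i j, j < i → T i j ≤ 0)
    (hdiag : ∀ i, 0 < T i i) {v : Fin n → ℝ} (hv : ∀ i, 0 ≤ T.mulVec v i) (i : Fin n) :
    0 ≤ v i := by
  induction i using WellFoundedLT.induction with
  | ind i ih =>
    have hi := hv i
    simp only [mulVec, dotProduct] at hi
    rw [← Finset.add_sum_erase _ _ (Finset.mem_univ i)] at hi
    have hoff : ∑ j ∈ Finset.univ.erase i, T i j * v j ≤ 0 := by
      refine Finset.sum_nonpos fun j hj => ?_
      rcases lt_or_gt_of_ne (Finset.ne_of_mem_erase hj) with hji | hij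
      · exact mul_nonpos_of_nonpos_of_nonneg (hlower i j hji) (ih j hji)
      · rw [hupper i j hij, zero_mul]
    exact nonneg_of_mul_nonneg_right (by linarith) (hdiag i)

/-- Two consecutive GGS iterates satisfy the entrywise bound
`|z − y| ≤ L̂ |y − x|` with `L̂ = (⟨D_A − L_A⟩ − |D_B − L_B|)⁻¹ (|U_A| + |U_B|)`. -/
theorem ggs_step_entrywise_bound {n : ℕ}
    (A B DA LA UA DB LB UB : Matrix (Fin n) (Fin n) ℝ)
    (hDA : ∀ i j : Fin n, i ≠ j → DA i j = 0)
    (hLA : ∀ i j : Fin n, ¬ j < i → LA i j = 0)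
    (hUA : ∀ i j : Fin n, ¬ i < j → UA i j = 0)
    (hA : A = DA - LA - UA)
    (hDB : ∀ i j : Fin n, i ≠ j → DB i j = 0)
    (hLB : ∀ i j : Fin n, ¬ j < i → LB i j = 0)
    (hUB : ∀ i j : Fin n, ¬ i < j → UB i j = 0)
    (hB : B = DB - LB - UB)
    (hdiag : ∀ i : Fin n, A i i > |B i i|)
    (hM : IsMMatrix (compMat A - matAbs B))
    (b x y z : Fin n → ℝ)
    (hy : (DA - LA).mulVec y - (DB - LB).mulVec (fun i => |y i|) =
      UA.mulVec x - UB.mulVec (fun i => |x i|) + b)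
    (hz : (DA - LA).mulVec z - (DB - LB).mulVec (fun i => |z i|) =
      UA.mulVec y - UB.mulVec (fun i => |y i|) + b) :
    ∀ i : Fin n, |(z - y) i| ≤
      ((compMat (DA - LA) - matAbs (DB - LB))⁻¹ * (matAbs UA + matAbs UB)).mulVec
        (fun i => |(y - x) i|) i := by
  set P := DA - LA with hP
  set Q := DB - LB with hQ
  set T := compMat P - matAbs Q with hT
  set d : Fin n → ℝ := fun i => |(z - y) i|
  set w : Fin n → ℝ := fun i => |(y - x) i|
  have hupper : ∀ i j, i < j → T i j = 0 := by
    intro i j hij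
    simp [hT, hP, hQ, compMat, matAbs, hij.ne, hDA i j hij.ne, hLA i j hij.not_gt,
      hDB i j hij.ne, hLB i j hij.not_gt]
  have hlower : ∀ i j, j < i → T i j ≤ 0 := by
    intro i j hij
    simp only [hT, compMat, matAbs, Matrix.sub_apply, of_apply, if_neg hij.ne']
    linarith [abs_nonneg (P i j), abs_nonneg (Q i j)]
  have hpos : ∀ i, 0 < T i i := by
    intro i
    have hi := hdiag i
    have hAP : A i i = P i i := by simp [hA, hP, hUA i i (lt_irrefl i)]
    have hBQ : B i i = Q i i := by simp [hB, hQ, hUB i i (lt_irrefl i)]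
    rw [hAP, hBQ] at hi
    simp only [hT, compMat, matAbs, Matrix.sub_apply, of_apply, if_true]
    linarith [le_abs_self (P i i)]
  have hdet : IsUnit T.det := by
    rw [det_of_isLowerTriangular T fun i j hij => hupper i j hij]
    exact (Finset.prod_pos fun i _ => hpos i).ne'.isUnit
  have hstep : ∀ i, T.mulVec d i ≤ (matAbs UA + matAbs UB).mulVec w i := by
    intro i
    have hdiff : P.mulVec (z - y) i = Q.mulVec ((fun i => |z i|) - fun i => |y i|) i +
        UA.mulVec (y - x) i - UB.mulVec ((fun i => |y i|) - fun i => |x i|) i := by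
      have hyi := congrFun hy i
      have hzi := congrFun hz i
      simp only [mulVec_sub, Pi.sub_apply, Pi.add_apply] at hyi hzi ⊢
      linarith
    have hcomp := compMat_mulVec_abs_le P (z - y) i
    have hQd := abs_mulVec_le_matAbs_mulVec Q (v := (fun i => |z i|) - fun i => |y i|) (u := d)
      (fun j => abs_abs_sub_abs_le (z j) (y j)) i
    have hUAw := abs_mulVec_le_matAbs_mulVec UA (v := y - x) (u := w) (fun j => le_rfl) i
    have hUBw := abs_mulVec_le_matAbs_mulVec UB (v := (fun i => |y i|) - fun i => |x i|) (u := w)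
      (fun j => abs_abs_sub_abs_le (y j) (x j)) i
    rw [hdiff] at hcomp
    have htri := hcomp.trans ((abs_sub _ _).trans (add_le_add_left (abs_add_le _ _) _))
    simp only [hT, sub_mulVec, add_mulVec, Pi.sub_apply, Pi.add_apply]
    linarith
  intro i
  have hnonneg := nonneg_of_lowerTriangular_mulVec_nonneg hupper hlower hpos
    (v := (T⁻¹ * (matAbs UA + matAbs UB)).mulVec w - d) (fun j => by
      rw [mulVec_sub, mulVec_mulVec, mul_nonsing_inv_cancel_left _ _ hdet, Pi.sub_apply]
      exact sub_nonneg.2 (hstep j)) i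
  exact sub_nonneg.1 hnonneg
end

section
/- Let A, B ∈ ℝ^{n×n}. Assume A_{ii} > |B_{ii}| for all i and that ⟨A⟩ − |B| is an M-matrix. Then for every b ∈ ℝ^n, the generalized absolute value equation A x − B |x| = b has exactly one solution x ∈ ℝ^n. -/
open Matrix

/-- The off-diagonal part of a square matrix. -/
def offDiagPart {n : ℕ} (A : Matrix (Fin n) (Fin n) ℝ) : Matrix (Fin n) (Fin n) ℝ :=
  Matrix.of fun i j => if i = j then 0 else A i j

lemma mulVec_eq_diag_add_offDiagPart {n : ℕ} (A : Matrix (Fin n) (Fin n) ℝ)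
    (x : Fin n → ℝ) (i : Fin n) :
    (A *ᵥ x) i = A i i * x i + ∑ j, offDiagPart A i j * x j := by
  have h : ∀ j, A i j * x j =
      (if i = j then A i j * x j else 0) + offDiagPart A i j * x j := by
    intro j
    by_cases hij : i = j <;> simp [offDiagPart, hij]
  rw [mulVec, dotProduct, Finset.sum_congr rfl fun j _ => h j, Finset.sum_add_distrib]
  simp

/-- The Jacobi iteration for `A x − B |x| = b` in the scaled variable `y = x / u`. -/
noncomputable def scaledJacobi {n : ℕ} (A B : Matrix (Fin n) (Fin n) ℝ) (u b y : Fin n → ℝ) :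
    Fin n → ℝ := fun i =>
  (b i + ∑ j, (B i j * |u j * y j| - offDiagPart A i j * (u j * y j))) / (A i i * u i)

lemma scaledJacobi_eq_self_iff {n : ℕ} {A B : Matrix (Fin n) (Fin n) ℝ} {u : Fin n → ℝ}
    (hpos : ∀ i, 0 < A i i * u i) (b y : Fin n → ℝ) :
    scaledJacobi A B u b y = y ↔
      A *ᵥ (fun i => u i * y i) - B *ᵥ (fun i => |u i * y i|) = b := by
  simp only [funext_iff]
  refine forall_congr' fun i => ?_
  rw [Pi.sub_apply, mulVec_eq_diag_add_offDiagPart A, scaledJacobi, div_eq_iff (hpos i).ne',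
    Finset.sum_sub_distrib]
  simp only [mulVec, dotProduct]
  constructor <;> intro h <;> linarith

lemma exists_contractingWith_scaledJacobi {n : ℕ} {A B : Matrix (Fin n) (Fin n) ℝ}
    {u : Fin n → ℝ} (hu : ∀ i, 0 ≤ u i) (hpos : ∀ i, 0 < A i i * u i)
    (hdom : ∀ i, ∑ j, (|B i j| + |offDiagPart A i j|) * u j < A i i * u i) (b : Fin n → ℝ) :
    ∃ K, ContractingWith K (scaledJacobi A B u b) := by
  have hsum : ∀ i, 0 ≤ ∑ j, (|B i j| + |offDiagPart A i j|) * u j := fun i =>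
    Finset.sum_nonneg fun j _ => mul_nonneg (by positivity) (hu j)
  let c : Fin n → NNReal := fun i =>
    ⟨(∑ j, (|B i j| + |offDiagPart A i j|) * u j) / (A i i * u i),
      div_nonneg (hsum i) (hpos i).le⟩
  refine ⟨Finset.univ.sup c, ?_, LipschitzWith.of_dist_le_mul fun y z => ?_⟩
  · rw [Finset.sup_lt_iff (by simp)]
    intro i _
    rw [← NNReal.coe_lt_coe]
    exact (div_lt_one (hpos i)).2 (hdom i)
  · refine (dist_pi_le_iff (by positivity)).2 fun i => ?_
    have hc : (c i : ℝ) ≤ (Finset.univ.sup c : NNReal) :=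
      NNReal.coe_le_coe.2 (Finset.le_sup (Finset.mem_univ i))
    refine le_trans ?_ (mul_le_mul_of_nonneg_right hc dist_nonneg)
    change _ ≤ (∑ j, (|B i j| + |offDiagPart A i j|) * u j) / (A i i * u i) * dist y z
    rw [Real.dist_eq, scaledJacobi, scaledJacobi, ← sub_div, abs_div, abs_of_pos (hpos i),
      div_mul_eq_mul_div, add_sub_add_left_eq_sub, ← Finset.sum_sub_distrib, Finset.sum_mul]
    refine div_le_div_of_nonneg_right ((Finset.abs_sum_le_sum_abs _ _).trans
      (Finset.sum_le_sum fun j _ => ?_)) (hpos i).le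
    have hyz : |u j * y j - u j * z j| ≤ u j * dist y z := by
      rw [← mul_sub, abs_mul, abs_of_nonneg (hu j), ← Real.dist_eq]
      exact mul_le_mul_of_nonneg_left (dist_le_pi_dist y z j) (hu j)
    calc |B i j * |u j * y j| - offDiagPart A i j * (u j * y j)
            - (B i j * |u j * z j| - offDiagPart A i j * (u j * z j))|
        = |B i j * (|u j * y j| - |u j * z j|)
            - offDiagPart A i j * (u j * y j - u j * z j)| := by ring_nf
      _ ≤ |B i j| * |(|u j * y j| - |u j * z j|)|
            + |offDiagPart A i j| * |u j * y j - u j * z j| := by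
          rw [← abs_mul, ← abs_mul]
          exact abs_sub _ _
      _ ≤ |B i j| * (u j * dist y z) + |offDiagPart A i j| * (u j * dist y z) := by
          gcongr
          exact (abs_abs_sub_abs_le _ _).trans hyz
      _ = (|B i j| + |offDiagPart A i j|) * u j * dist y z := by ring

lemma IsMMatrix.exists_nonneg_mulVec_eq_one {n : ℕ} {M : Matrix (Fin n) (Fin n) ℝ}
    (hM : IsMMatrix M) : ∃ u : Fin n → ℝ, (∀ i, 0 ≤ u i) ∧ M *ᵥ u = 1 := by
  refine ⟨M⁻¹ *ᵥ 1, fun i => ?_, ?_⟩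
  · simpa only [mulVec, dotProduct, Pi.one_apply, mul_one] using
      Finset.sum_nonneg fun j _ => hM.2.2 i j
  · rw [mulVec_mulVec, mul_nonsing_inv _ ((isUnit_iff_isUnit_det M).1 hM.2.1), one_mulVec]

lemma compMat_sub_matAbs_mulVec {n : ℕ} (A B : Matrix (Fin n) (Fin n) ℝ) (u : Fin n → ℝ)
    (i : Fin n) :
    ((compMat A - matAbs B) *ᵥ u) i =
      |A i i| * u i - ∑ j, (|B i j| + |offDiagPart A i j|) * u j := by
  rw [sub_mulVec, Pi.sub_apply, mulVec_eq_diag_add_offDiagPart (compMat A)]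
  have h : ∀ j, offDiagPart (compMat A) i j = -|offDiagPart A i j| := by
    intro j
    by_cases hij : i = j <;> simp [offDiagPart, compMat, hij]
  simp only [h, mulVec, dotProduct, add_mul, Finset.sum_add_distrib, neg_mul,
    Finset.sum_neg_distrib]
  simp only [compMat, matAbs, of_apply, if_true]
  ring

/-- If `A_{ii} > |B_{ii}|` for all `i` and `⟨A⟩ − |B|` is an M-matrix, then for every
`b ∈ ℝ^n` the GAVE `A x − B |x| = b` has exactly one solution. -/
theorem gave_unique_solution_of_Mmatrix {n : ℕ}
    (A B : Matrix (Fin n) (Fin n) ℝ)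
    (hdiag : ∀ i : Fin n, A i i > |B i i|)
    (hM : IsMMatrix (compMat A - matAbs B)) :
    ∀ b : Fin n → ℝ, ∃! x : Fin n → ℝ,
      A.mulVec x - B.mulVec (fun i => |x i|) = b := by
  intro b
  obtain ⟨u, hu, hMu⟩ := hM.exists_nonneg_mulVec_eq_one
  have hA : ∀ i, 0 < A i i := fun i => (abs_nonneg _).trans_lt (hdiag i)
  have hone : ∀ i, A i i * u i - ∑ j, (|B i j| + |offDiagPart A i j|) * u j = 1 := by
    intro i
    rw [← abs_of_pos (hA i), ← compMat_sub_matAbs_mulVec, hMu, Pi.one_apply]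
  have hdom : ∀ i, ∑ j, (|B i j| + |offDiagPart A i j|) * u j < A i i * u i := fun i => by
    linarith [hone i]
  have hpos : ∀ i, 0 < A i i * u i := fun i =>
    (Finset.sum_nonneg fun j _ => mul_nonneg (by positivity) (hu j)).trans_lt (hdom i)
  have hu_ne : ∀ i, u i ≠ 0 := fun i => right_ne_zero_of_mul (hpos i).ne'
  obtain ⟨K, hK⟩ := exists_contractingWith_scaledJacobi hu hpos hdom b
  refine ⟨fun i => u i * hK.fixedPoint _ i,
    (scaledJacobi_eq_self_iff hpos b _).1 hK.fixedPoint_isFixedPt, fun x hx => ?_⟩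
  have hfix : Function.IsFixedPt (scaledJacobi A B u b) fun i => x i / u i := by
    refine (scaledJacobi_eq_self_iff hpos b _).2 ?_
    simpa only [mul_div_cancel₀ _ (hu_ne _)] using hx
  rw [← hK.fixedPoint_unique hfix]
  exact funext fun i => (mul_div_cancel₀ _ (hu_ne i)).symm
end

section
/- Let A, B ∈ ℝ^{n×n} with decompositions A = D_A − L_A − U_A and B = D_B − L_B − U_B into diagonal, strictly lower triangular, and strictly upper triangular parts, and let b ∈ ℝ^n. Assume A_{ii} > |B_{ii}| for all i. Then for every x ∈ ℝ^n there exists a unique y ∈ ℝ^n satisfying the GGS step equation (D_A − L_A)y − (D_B − L_B)|y| = U_A x − U_B |x| + b; in particular, for every initial vector x^{(0)} ∈ ℝ^n, the GGS iteration generates a uniquely determined sequence (x^{(k)})_{k≥0}. -/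
open Matrix

/-- A map whose `i`-th output depends only on inputs of smaller index has a unique fixed point. -/
theorem existsUnique_fixedPoint_of_causal {ι α : Type*} [Preorder ι] [WellFoundedLT ι]
    [Inhabited α] (F : (ι → α) → ι → α)
    (hF : ∀ (y z : ι → α) (i : ι), (∀ j < i, y j = z j) → F y i = F z i) :
    ∃! y : ι → α, ∀ i, y i = F y i := by
  classical
  let y : ι → α := (wellFounded_lt (α := ι)).fix fun i ih =>
    F (fun j => if h : j < i then ih j h else default) i
  refine ⟨y, fun i => ?_, fun z hz => ?_⟩
  · rw [show y i = F (fun j => if _h : j < i then y j else default) i from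
      WellFounded.fix_eq _ _ _]
    exact hF _ _ _ fun j hj => by simp [hj]
  · have hy (i : ι) : y i = F y i := by
      rw [show y i = F (fun j => if _h : j < i then y j else default) i from
        WellFounded.fix_eq _ _ _]
      exact hF _ _ _ fun j hj => by simp [hj]
    funext i
    induction i using WellFoundedLT.induction with
    | ind i ih => rw [hz i, hy i, hF z y i ih]

/-- The explicit solution of the scalar absolute value equation. -/
theorem mul_sub_mul_abs_eq_iff {m p : ℝ} (h : |p| < m) (s t : ℝ) :
    m * s - p * |s| = t ↔ s = if 0 ≤ t then t / (m - p) else t / (m + p) := by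
  obtain ⟨h₁, h₂⟩ := abs_lt.mp h
  have hm : 0 < m - p := by linarith
  have hp : 0 < m + p := by linarith
  constructor
  · rintro rfl
    rcases le_or_gt 0 s with hs | hs
    · rw [abs_of_nonneg hs, if_pos (by nlinarith), eq_div_iff hm.ne']
      ring
    · rw [abs_of_neg hs, if_neg (by nlinarith), eq_div_iff hp.ne']
      ring
  · rintro rfl
    split_ifs with ht
    · rw [abs_of_nonneg (by positivity)]
      field_simp
    · rw [abs_of_neg (div_neg_of_neg_of_pos (not_le.mp ht) hp)]
      field_simp
      ring

theorem mulVec_apply_of_lower {n : ℕ} {M : Matrix (Fin n) (Fin n) ℝ}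
    (hM : ∀ i j, i < j → M i j = 0) (y : Fin n → ℝ) (i : Fin n) :
    (M *ᵥ y) i = M i i * y i + ∑ j ∈ Finset.Iio i, M i j * y j := by
  rw [← Finset.sum_insert (f := fun j => M i j * y j) (by simp), Finset.Iio_insert]
  refine (Finset.sum_subset (Finset.subset_univ (Finset.Iic i)) fun j _ hj => ?_).symm
  exact mul_eq_zero_of_left (hM i j (by simpa using hj)) _

/-- A lower triangular generalized absolute value equation whose diagonal is dominated by the
linear part is uniquely solvable, by forward substitution. -/
theorem existsUnique_lower_absoluteValueEquation {n : ℕ} {M N : Matrix (Fin n) (Fin n) ℝ}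
    (hM : ∀ i j, i < j → M i j = 0) (hN : ∀ i j, i < j → N i j = 0)
    (hMN : ∀ i, |N i i| < M i i) (c : Fin n → ℝ) :
    ∃! y : Fin n → ℝ, M *ᵥ y - N *ᵥ (fun i => |y i|) = c := by
  let r (y : Fin n → ℝ) (i : Fin n) : ℝ :=
    c i - ∑ j ∈ Finset.Iio i, M i j * y j + ∑ j ∈ Finset.Iio i, N i j * |y j|
  have key (y : Fin n → ℝ) : M *ᵥ y - N *ᵥ (fun i => |y i|) = c ↔
      ∀ i, y i = if 0 ≤ r y i then r y i / (M i i - N i i) else r y i / (M i i + N i i) := by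
    rw [funext_iff]
    refine forall_congr' fun i => ?_
    rw [← mul_sub_mul_abs_eq_iff (hMN i), Pi.sub_apply, mulVec_apply_of_lower hM,
      mulVec_apply_of_lower hN]
    constructor <;> intro h <;> linarith
  simp only [key]
  refine existsUnique_fixedPoint_of_causal (fun y i =>
    if 0 ≤ r y i then r y i / (M i i - N i i) else r y i / (M i i + N i i)) fun y z i h => ?_
  have hr : r y i = r z i := by
    simp only [r]
    congr 1
    · congr 1
      exact Finset.sum_congr rfl fun j hj => by rw [h j (Finset.mem_Iio.mp hj)]
    · exact Finset.sum_congr rfl fun j hj => by rw [h j (Finset.mem_Iio.mp hj)]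
  simp only [hr]

/-- A relation that determines a unique successor of every state determines a unique orbit. -/
theorem existsUnique_orbit {α : Type*} {R : α → α → Prop} (hR : ∀ x, ∃! y, R x y) (x₀ : α) :
    ∃! x : ℕ → α, x 0 = x₀ ∧ ∀ k, R (x k) (x (k + 1)) := by
  choose f hf huniq using hR
  refine ⟨fun k => Nat.rec x₀ (fun _ => f) k, ⟨rfl, fun k => hf _⟩, ?_⟩
  rintro z ⟨hz₀, hz⟩
  funext k
  induction k with
  | zero => exact hz₀
  | succ k ih => rw [huniq _ _ (hz k), ih]

/-- If `A_{ii} > |B_{ii}|` for all `i`, then each GGS step has a unique outcome; in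
particular, for every initial vector the GGS iteration generates a uniquely determined
sequence. -/
theorem ggs_step_well_defined {n : ℕ}
    (A B DA LA UA DB LB UB : Matrix (Fin n) (Fin n) ℝ)
    (hDA : ∀ i j : Fin n, i ≠ j → DA i j = 0)
    (hLA : ∀ i j : Fin n, ¬ j < i → LA i j = 0)
    (hUA : ∀ i j : Fin n, ¬ i < j → UA i j = 0)
    (hA : A = DA - LA - UA)
    (hDB : ∀ i j : Fin n, i ≠ j → DB i j = 0)
    (hLB : ∀ i j : Fin n, ¬ j < i → LB i j = 0)
    (hUB : ∀ i j : Fin n, ¬ i < j → UB i j = 0)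
    (hB : B = DB - LB - UB)
    (hdiag : ∀ i : Fin n, A i i > |B i i|)
    (b : Fin n → ℝ) :
    (∀ x : Fin n → ℝ, ∃! y : Fin n → ℝ,
      (DA - LA).mulVec y - (DB - LB).mulVec (fun i => |y i|) =
        UA.mulVec x - UB.mulVec (fun i => |x i|) + b) ∧
    (∀ x0 : Fin n → ℝ, ∃! x : ℕ → Fin n → ℝ,
      x 0 = x0 ∧ ∀ k : ℕ,
        (DA - LA).mulVec (x (k + 1)) - (DB - LB).mulVec (fun i => |x (k + 1) i|) =
          UA.mulVec (x k) - UB.mulVec (fun i => |x k i|) + b) := by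
  have lower {D L : Matrix (Fin n) (Fin n) ℝ} (hD : ∀ i j, i ≠ j → D i j = 0)
      (hL : ∀ i j, ¬ j < i → L i j = 0) (i j : Fin n) (hij : i < j) : (D - L) i j = 0 := by
    simp [hD i j hij.ne, hL i j hij.not_gt]
  have step (x : Fin n → ℝ) : ∃! y : Fin n → ℝ,
      (DA - LA).mulVec y - (DB - LB).mulVec (fun i => |y i|) =
        UA.mulVec x - UB.mulVec (fun i => |x i|) + b := by
    refine existsUnique_lower_absoluteValueEquation (lower hDA hLA) (lower hDB hLB)
      (fun i => ?_) _
    simpa [hA, hB, hUA i i (lt_irrefl i), hUB i i (lt_irrefl i)] using hdiag i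
  exact ⟨step, existsUnique_orbit step⟩
end
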